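/- arXiv:1407.2436 — 2 statements merged into one kernel-verified Lean document; each statement's English description precedes it below -/
import Mathlib

section
/- For λ > 0 there exists C > 0 such that the Bessel–Poisson kernel satisfies |∂_t P_t^λ(x,y)| ≤ C (xy)^λ / ((x-y)² + t²)^{λ+1} and also |∂_t P_t^λ(x,y)| ≤ C / ((x-y)² + t²), for all x, y, t ∈ (0,∞). -/
open MeasureTheory Real Set

/-- The Bessel–Poisson kernel `P_t^λ(x,y)`. -/
noncomputable def besselPoissonKernel (l x y t : ℝ) : ℝ :=
  2 * l * (x * y) ^ l * t / π *
    ∫ θ in (0:ℝ)..π, Real.sin θ ^ (2 * l - 1) /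
      ((x - y) ^ 2 + t ^ 2 + 2 * x * y * (1 - Real.cos θ)) ^ (l + 1)

/-- `D_{λ,x} P_t^λ(x,y)`, where `D_λ = x^λ ∂_x x^{-λ}`. -/
noncomputable def DxBesselPoissonKernel (l x y t : ℝ) : ℝ :=
  -(4 * l * (l + 1) / π) * (x * y) ^ l * t *
    ∫ θ in (0:ℝ)..π, Real.sin θ ^ (2 * l - 1) * (x - y * Real.cos θ) /
      ((x - y) ^ 2 + t ^ 2 + 2 * x * y * (1 - Real.cos θ)) ^ (l + 2)

lemma aux_deriv (l A c : ℝ) (hA : 0 < A) (hc : 0 ≤ c) (θ : ℝ) (hθ : θ ∈ Ioo 0 π) :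
    HasDerivAt (fun θ => ((1 - Real.cos θ) / (A + c * (1 - Real.cos θ))) ^ l)
      (l * A * (Real.sin θ * (1 - Real.cos θ) ^ (l - 1) /
        (A + c * (1 - Real.cos θ)) ^ (l + 1))) θ := by
  have hs : 0 < Real.sin θ := Real.sin_pos_of_mem_Ioo hθ
  have hu : 0 < 1 - Real.cos θ := by
    nlinarith [Real.sin_sq_add_cos_sq θ, Real.cos_le_one θ, Real.neg_one_le_cos θ]
  have hw : 0 < A + c * (1 - Real.cos θ) := by positivity
  have h1 : HasDerivAt (fun θ => 1 - Real.cos θ) (Real.sin θ) θ := by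
    simpa using (Real.hasDerivAt_cos θ).const_sub 1
  have h2 := (h1.div ((h1.const_mul c).const_add A) hw.ne').rpow_const (p := l)
    (Or.inl (div_pos hu hw).ne')
  refine h2.congr_deriv ?_
  simp only [Pi.div_apply]
  rw [Real.div_rpow hu.le hw.le, show l + 1 = (l - 1) + 2 by ring, Real.rpow_add hw,
    Real.rpow_two]
  have := Real.rpow_pos_of_pos hw (l - 1)
  field_simp
  ring

lemma aux_cont (l A c : ℝ) (hl : 0 < l) (hA : 0 < A) (hc : 0 ≤ c) :
    Continuous (fun θ => ((1 - Real.cos θ) / (A + c * (1 - Real.cos θ))) ^ l) := by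
  refine Continuous.rpow_const ?_ (fun _ => Or.inr hl.le)
  refine Continuous.div (by fun_prop) (by fun_prop) (fun θ => ?_)
  have : 0 ≤ 1 - Real.cos θ := by linarith [Real.cos_le_one θ]
  positivity

lemma aux_int (l A c : ℝ) (hl : 0 < l) (hA : 0 < A) (hc : 0 ≤ c) :
    IntervalIntegrable (fun θ => l * A * (Real.sin θ * (1 - Real.cos θ) ^ (l - 1) /
        (A + c * (1 - Real.cos θ)) ^ (l + 1))) volume 0 π := by
  refine intervalIntegral.intervalIntegrable_deriv_of_nonneg
    (aux_cont l A c hl hA hc).continuousOn ?_ ?_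
  · rw [min_eq_left pi_pos.le, max_eq_right pi_pos.le]
    exact aux_deriv l A c hA hc
  · rw [min_eq_left pi_pos.le, max_eq_right pi_pos.le]
    intro θ hθ
    have hs : 0 < Real.sin θ := Real.sin_pos_of_mem_Ioo hθ
    have : 0 ≤ 1 - Real.cos θ := by linarith [Real.cos_le_one θ]
    positivity

lemma aux_int' (l A c : ℝ) (hl : 0 < l) (hA : 0 < A) (hc : 0 ≤ c) :
    IntervalIntegrable (fun θ => (Real.sin θ * (1 - Real.cos θ) ^ (l - 1) /
        (A + c * (1 - Real.cos θ)) ^ (l + 1))) volume 0 π := by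
  have := (aux_int l A c hl hA hc).const_mul (l * A)⁻¹
  refine this.congr (fun θ _ => ?_)
  have : l * A ≠ 0 := by positivity
  field_simp

lemma aux_val (l A c : ℝ) (hl : 0 < l) (hA : 0 < A) (hc : 0 < c) :
    c ^ l * ∫ θ in (0:ℝ)..π, (Real.sin θ * (1 - Real.cos θ) ^ (l - 1) /
        (A + c * (1 - Real.cos θ)) ^ (l + 1)) ≤ 1 / (l * A) := by
  have h := intervalIntegral.integral_eq_sub_of_hasDerivAt_of_le pi_pos.le
    (aux_cont l A c hl hA hc.le).continuousOn (aux_deriv l A c hA hc.le) (aux_int l A c hl hA hc.le)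
  rw [intervalIntegral.integral_const_mul] at h
  simp only [Real.cos_pi, Real.cos_zero, sub_self, zero_div, Real.zero_rpow hl.ne', sub_zero] at h
  rw [le_div_iff₀ (by positivity), mul_assoc, mul_comm _ (l * A), h,
    ← Real.mul_rpow hc.le (by norm_num; positivity)]
  apply Real.rpow_le_one (by norm_num; positivity) _ hl.le
  rw [← mul_div_assoc, div_le_one (by norm_num; positivity)]
  linarith

lemma aux_one_add (l u : ℝ) (hl : 0 < l) (h1 : 1 ≤ u) (h2 : u ≤ 2) : u ^ (l - 1) ≤ 2 ^ l := by
  calc u ^ (l - 1) ≤ u ^ l := Real.rpow_le_rpow_of_exponent_le h1 (by linarith)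
    _ ≤ 2 ^ l := Real.rpow_le_rpow (by linarith) h2 hl.le

lemma aux_sin (l θ : ℝ) (hθ : θ ∈ Ioo 0 π) : Real.sin θ ^ (2 * l - 1) =
    Real.sin θ * (1 - Real.cos θ) ^ (l - 1) * (1 + Real.cos θ) ^ (l - 1) := by
  have hs : 0 < Real.sin θ := Real.sin_pos_of_mem_Ioo hθ
  have hu : 0 ≤ 1 - Real.cos θ := by linarith [Real.cos_le_one θ]
  have hv : 0 ≤ 1 + Real.cos θ := by linarith [Real.neg_one_le_cos θ]
  rw [mul_assoc, ← Real.mul_rpow hu hv,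
    show (1 - Real.cos θ) * (1 + Real.cos θ) = Real.sin θ ^ (2:ℝ) by
      rw [Real.rpow_two]; nlinarith [Real.sin_sq_add_cos_sq θ],
    ← Real.rpow_mul hs.le]
  nth_rewrite 2 [← Real.rpow_one (Real.sin θ)]
  rw [← Real.rpow_add hs]
  ring_nf

lemma aux_near (l θ : ℝ) (hl : 0 < l) (hθ : θ ∈ Ioo 0 π) (hc : 0 ≤ Real.cos θ) :
    Real.sin θ ^ (2 * l - 1) ≤ 2 ^ l * (Real.sin θ * (1 - Real.cos θ) ^ (l - 1)) := by
  have hs : 0 < Real.sin θ := Real.sin_pos_of_mem_Ioo hθ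
  have hu : 0 ≤ 1 - Real.cos θ := by linarith [Real.cos_le_one θ]
  rw [aux_sin l θ hθ, mul_comm]
  exact mul_le_mul_of_nonneg_right
    (aux_one_add l _ hl (by linarith) (by linarith [Real.cos_le_one θ])) (by positivity)

lemma aux_far (l θ : ℝ) (hl : 0 < l) (hθ : θ ∈ Ioo 0 π) (hc : Real.cos θ ≤ 0) :
    Real.sin θ ^ (2 * l - 1) ≤ 2 ^ l * (Real.sin θ * (1 + Real.cos θ) ^ (l - 1)) := by
  have hs : 0 < Real.sin θ := Real.sin_pos_of_mem_Ioo hθ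
  have hu : 0 ≤ 1 + Real.cos θ := by linarith [Real.neg_one_le_cos θ]
  have h := aux_one_add l (1 - Real.cos θ) hl (by linarith) (by linarith [Real.neg_one_le_cos θ])
  rw [aux_sin l θ hθ]
  have h3 : 0 ≤ Real.sin θ * (1 + Real.cos θ) ^ (l - 1) := by positivity
  nlinarith [mul_le_mul_of_nonneg_right h h3]

lemma sin_pow_int (l : ℝ) (hl : 0 < l) :
    IntervalIntegrable (fun θ => Real.sin θ ^ (2 * l - 1)) volume 0 π := by
  have h1 : IntervalIntegrable (fun θ => Real.sin θ * (1 - Real.cos θ) ^ (l - 1)) volume 0 π := by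
    simpa using aux_int' l 1 0 hl one_pos le_rfl
  have h2 : IntervalIntegrable (fun θ => Real.sin θ * (1 + Real.cos θ) ^ (l - 1)) volume 0 π := by
    have := (h1.comp_sub_left π).symm
    simpa using this
  have h3 := (h1.add h2).const_mul (2 ^ l)
  refine h3.mono_fun' (Measurable.aestronglyMeasurable (by fun_prop)) ?_
  rw [uIoc_of_le pi_pos.le, ← Measure.restrict_congr_set Ioo_ae_eq_Ioc]
  refine (ae_restrict_iff' measurableSet_Ioo).2 (ae_of_all _ fun θ hθ => ?_)
  have hs : 0 < Real.sin θ := Real.sin_pos_of_mem_Ioo hθ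
  have hu : 0 ≤ 1 - Real.cos θ := by linarith [Real.cos_le_one θ]
  have hv : 0 ≤ 1 + Real.cos θ := by linarith [Real.neg_one_le_cos θ]
  have p1 : 0 ≤ (2:ℝ) ^ l * (Real.sin θ * (1 + Real.cos θ) ^ (l - 1)) := by positivity
  have p2 : 0 ≤ (2:ℝ) ^ l * (Real.sin θ * (1 - Real.cos θ) ^ (l - 1)) := by positivity
  simp only [mul_add]
  rw [Real.norm_of_nonneg (by positivity)]
  rcases le_total 0 (Real.cos θ) with h | h
  · linarith [aux_near l θ hl hθ h]
  · linarith [aux_far l θ hl hθ h]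

/-- Weighted integrands against continuous positive powers are integrable. -/
lemma ker_int (l A c p : ℝ) (hl : 0 < l) (hA : 0 < A) (hc : 0 ≤ c) :
    IntervalIntegrable (fun θ => Real.sin θ ^ (2 * l - 1) /
      (A + c * (1 - Real.cos θ)) ^ p) volume 0 π := by
  simp only [div_eq_mul_inv]
  have hpos : ∀ θ : ℝ, 0 < A + c * (1 - Real.cos θ) := fun θ => by
    have : 0 ≤ 1 - Real.cos θ := by linarith [Real.cos_le_one θ]
    positivity
  refine (sin_pow_int l hl).mul_continuousOn (Continuous.continuousOn ?_)
  refine Continuous.inv₀ (Continuous.rpow_const (by fun_prop) fun θ => Or.inl (hpos θ).ne')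
    fun θ => (Real.rpow_pos_of_pos (hpos θ) p).ne'

lemma ker_bound1 (l A c : ℝ) (hl : 0 < l) (hA : 0 < A) (hc : 0 ≤ c) :
    ∫ θ in (0:ℝ)..π, Real.sin θ ^ (2 * l - 1) / (A + c * (1 - Real.cos θ)) ^ (l + 1) ≤
      (∫ θ in (0:ℝ)..π, Real.sin θ ^ (2 * l - 1)) / A ^ (l + 1) := by
  rw [← intervalIntegral.integral_div]
  refine intervalIntegral.integral_mono_on_of_le_Ioo pi_pos.le (ker_int l A c _ hl hA hc)
    ((sin_pow_int l hl).div_const _) fun θ hθ => ?_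
  have hs : 0 < Real.sin θ := Real.sin_pos_of_mem_Ioo hθ
  have hu : 0 ≤ 1 - Real.cos θ := by linarith [Real.cos_le_one θ]
  have : A ≤ A + c * (1 - Real.cos θ) := by nlinarith [mul_nonneg hc hu]
  gcongr

lemma ker_bound2 (l A c : ℝ) (hl : 0 < l) (hA : 0 < A) (hc : 0 < c) :
    c ^ l * ∫ θ in (0:ℝ)..π, Real.sin θ ^ (2 * l - 1) / (A + c * (1 - Real.cos θ)) ^ (l + 1) ≤
      (2 ^ l / l + ∫ θ in (0:ℝ)..π, Real.sin θ ^ (2 * l - 1)) / A := by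
  have h1 := ((aux_int' l A c hl hA hc.le).const_mul (c ^ l)).const_mul (2 ^ l)
  have h2 := (sin_pow_int l hl).div_const A
  rw [← intervalIntegral.integral_const_mul]
  have key : ∫ θ in (0:ℝ)..π, c ^ l * (Real.sin θ ^ (2 * l - 1) /
      (A + c * (1 - Real.cos θ)) ^ (l + 1)) ≤ ∫ θ in (0:ℝ)..π,
      (2 ^ l * (c ^ l * (Real.sin θ * (1 - Real.cos θ) ^ (l - 1) /
        (A + c * (1 - Real.cos θ)) ^ (l + 1))) + Real.sin θ ^ (2 * l - 1) / A) := by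
    refine intervalIntegral.integral_mono_on_of_le_Ioo pi_pos.le
      ((ker_int l A c _ hl hA hc.le).const_mul _) (h1.add h2) fun θ hθ => ?_
    have hs : 0 < Real.sin θ := Real.sin_pos_of_mem_Ioo hθ
    have hu : 0 ≤ 1 - Real.cos θ := by linarith [Real.cos_le_one θ]
    have hw : 0 < A + c * (1 - Real.cos θ) := by positivity
    rcases le_total 0 (Real.cos θ) with h | h
    · have := aux_near l θ hl hθ h
      have e : c ^ l * (Real.sin θ ^ (2 * l - 1) / (A + c * (1 - Real.cos θ)) ^ (l + 1)) ≤
          c ^ l * (2 ^ l * (Real.sin θ * (1 - Real.cos θ) ^ (l - 1)) /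
            (A + c * (1 - Real.cos θ)) ^ (l + 1)) := by gcongr
      have p : 0 ≤ Real.sin θ ^ (2 * l - 1) / A := by positivity
      refine e.trans ((le_of_eq ?_).trans (le_add_of_nonneg_right p))
      ring
    · have p : 0 ≤ 2 ^ l * (c ^ l * (Real.sin θ * (1 - Real.cos θ) ^ (l - 1) /
        (A + c * (1 - Real.cos θ)) ^ (l + 1))) := by positivity
      refine le_trans ?_ (le_add_of_nonneg_left p)
      have hcw : c ≤ A + c * (1 - Real.cos θ) := by nlinarith
      have hAw : A ≤ A + c * (1 - Real.cos θ) := by nlinarith [mul_nonneg hc.le hu]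
      have e : c ^ l * A ≤ (A + c * (1 - Real.cos θ)) ^ (l + 1) := by
        rw [Real.rpow_add hw, Real.rpow_one]
        gcongr
      rw [← mul_div_assoc, div_le_div_iff₀ (by positivity) hA]
      have p2 : 0 ≤ Real.sin θ ^ (2 * l - 1) := by positivity
      nlinarith [mul_le_mul_of_nonneg_left e p2]
  refine key.trans ?_
  rw [intervalIntegral.integral_add h1 h2, intervalIntegral.integral_const_mul,
    intervalIntegral.integral_const_mul, intervalIntegral.integral_div, add_div]
  have := mul_le_mul_of_nonneg_left (aux_val l A c hl hA hc) (by positivity : (0:ℝ) ≤ 2 ^ l)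
  have e : (2:ℝ) ^ l * (1 / (l * A)) = 2 ^ l / l / A := by field_simp
  linarith

lemma ker_deriv (l Q c t : ℝ) (hl : 0 < l) (hQ : 0 ≤ Q) (hc : 0 ≤ c) (ht : 0 < t) :
    HasDerivAt (fun s => ∫ θ in (0:ℝ)..π, Real.sin θ ^ (2 * l - 1) /
      (Q + s ^ 2 + c * (1 - Real.cos θ)) ^ (l + 1))
      (∫ θ in (0:ℝ)..π, -(2 * (l + 1) * t) * (Real.sin θ ^ (2 * l - 1) /
      (Q + t ^ 2 + c * (1 - Real.cos θ)) ^ (l + 2))) t := by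
  have hbd := ((sin_pow_int l hl).div_const (((t / 2) ^ 2) ^ (l + 2))).const_mul
    (2 * (l + 1) * (2 * t))
  refine (intervalIntegral.hasDerivAt_integral_of_dominated_loc_of_deriv_le
    (F' := fun s θ => -(2 * (l + 1) * s) * (Real.sin θ ^ (2 * l - 1) /
      (Q + s ^ 2 + c * (1 - Real.cos θ)) ^ (l + 2)))
    (Ioo_mem_nhds (by linarith : t / 2 < t) (by linarith : t < 2 * t)) ?_ ?_ ?_ ?_ hbd ?_).2
  · exact Filter.Eventually.of_forall fun s => Measurable.aestronglyMeasurable (by fun_prop)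
  · exact ker_int l _ c _ hl (by positivity) hc
  · exact Measurable.aestronglyMeasurable (by fun_prop)
  · refine ae_of_all _ fun θ hθ s hs => ?_
    rw [uIoc_of_le pi_pos.le] at hθ
    have hs0 : 0 < s := by linarith [hs.1]
    have hsin : 0 ≤ Real.sin θ := Real.sin_nonneg_of_nonneg_of_le_pi hθ.1.le hθ.2
    have hu : 0 ≤ 1 - Real.cos θ := by linarith [Real.cos_le_one θ]
    have hD : (t / 2) ^ 2 ≤ Q + s ^ 2 + c * (1 - Real.cos θ) := by
      nlinarith [mul_nonneg hc hu, hs.1]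
    have hs2 := hs.2.le
    rw [norm_mul, norm_neg, Real.norm_of_nonneg (by positivity), Real.norm_of_nonneg (by positivity)]
    gcongr
  · refine ae_of_all _ fun θ hθ s hs => ?_
    have hs0 : 0 < s := by linarith [hs.1]
    have hu : 0 ≤ 1 - Real.cos θ := by linarith [Real.cos_le_one θ]
    have hD : 0 < Q + s ^ 2 + c * (1 - Real.cos θ) := by positivity
    have h1 : HasDerivAt (fun s : ℝ => Q + s ^ 2 + c * (1 - Real.cos θ)) (2 * s) s := by
      simpa using ((hasDerivAt_pow 2 s).const_add Q).add_const (c * (1 - Real.cos θ))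
    have h2 := (h1.rpow_const (p := -(l + 1)) (Or.inl hD.ne')).const_mul
      (Real.sin θ ^ (2 * l - 1))
    have h3 : HasDerivAt (fun s : ℝ => Real.sin θ ^ (2 * l - 1) /
      (Q + s ^ 2 + c * (1 - Real.cos θ)) ^ (l + 1)) (Real.sin θ ^ (2 * l - 1) * (2 * s * -(l + 1) *
        (Q + s ^ 2 + c * (1 - Real.cos θ)) ^ (-(l + 1) - 1))) s := by
      refine h2.congr_of_eventuallyEq (Filter.Eventually.of_forall fun r => ?_)
      have hr : 0 ≤ Q + r ^ 2 + c * (1 - Real.cos θ) := by positivity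
      simp only
      rw [Real.rpow_neg hr, div_eq_mul_inv]
    refine h3.congr_deriv ?_
    rw [show -(l + 1) - 1 = -(l + 2) by ring, Real.rpow_neg hD.le]
    ring

lemma ker_deriv_bound (l x y t : ℝ) (hl : 0 < l) (hx : 0 < x) (hy : 0 < y) (ht : 0 < t) :
    |deriv (fun s => besselPoissonKernel l x y s) t| ≤ 2 * l / π * (2 * l + 3) * ((x * y) ^ l *
      ∫ θ in (0:ℝ)..π, Real.sin θ ^ (2 * l - 1) /
      ((x - y) ^ 2 + t ^ 2 + 2 * x * y * (1 - Real.cos θ)) ^ (l + 1)) := by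
  have hc : 0 ≤ 2 * x * y := by positivity
  have hA : 0 < (x - y) ^ 2 + t ^ 2 := by positivity
  have hI := ker_deriv l ((x - y) ^ 2) (2 * x * y) t hl (sq_nonneg _) hc ht
  have hlin : HasDerivAt (fun s : ℝ => 2 * l * (x * y) ^ l * s / π)
      (2 * l * (x * y) ^ l / π) t := by
    simpa using ((hasDerivAt_id t).const_mul (2 * l * (x * y) ^ l)).div_const π
  have hd := (hlin.mul hI).deriv
  have e0 : (fun s => besselPoissonKernel l x y s) = (fun s : ℝ => 2 * l * (x * y) ^ l * s / π) *
      (fun s => ∫ θ in (0:ℝ)..π, Real.sin θ ^ (2 * l - 1) /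
      ((x - y) ^ 2 + s ^ 2 + 2 * x * y * (1 - Real.cos θ)) ^ (l + 1)) := rfl
  rw [e0, hd, intervalIntegral.integral_const_mul]
  have k1 := ker_int l _ (2 * x * y) (l + 1) hl hA hc
  have k2 := ker_int l _ (2 * x * y) (l + 2) hl hA hc
  have J0 : 0 ≤ ∫ θ in (0:ℝ)..π, Real.sin θ ^ (2 * l - 1) /
      ((x - y) ^ 2 + t ^ 2 + 2 * x * y * (1 - Real.cos θ)) ^ (l + 2) := by
    refine intervalIntegral.integral_nonneg pi_pos.le fun θ hθ => ?_
    have hsin : 0 ≤ Real.sin θ := Real.sin_nonneg_of_nonneg_of_le_pi hθ.1 hθ.2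
    have hu : 0 ≤ 1 - Real.cos θ := by linarith [Real.cos_le_one θ]
    positivity
  have I0 : 0 ≤ ∫ θ in (0:ℝ)..π, Real.sin θ ^ (2 * l - 1) /
      ((x - y) ^ 2 + t ^ 2 + 2 * x * y * (1 - Real.cos θ)) ^ (l + 1) := by
    refine intervalIntegral.integral_nonneg pi_pos.le fun θ hθ => ?_
    have hsin : 0 ≤ Real.sin θ := Real.sin_nonneg_of_nonneg_of_le_pi hθ.1 hθ.2
    have hu : 0 ≤ 1 - Real.cos θ := by linarith [Real.cos_le_one θ]
    positivity
  have hJI : t ^ 2 * (∫ θ in (0:ℝ)..π, Real.sin θ ^ (2 * l - 1) /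
      ((x - y) ^ 2 + t ^ 2 + 2 * x * y * (1 - Real.cos θ)) ^ (l + 2)) ≤
      ∫ θ in (0:ℝ)..π, Real.sin θ ^ (2 * l - 1) /
      ((x - y) ^ 2 + t ^ 2 + 2 * x * y * (1 - Real.cos θ)) ^ (l + 1) := by
    rw [← intervalIntegral.integral_const_mul]
    refine intervalIntegral.integral_mono_on_of_le_Ioo pi_pos.le (k2.const_mul _) k1
      fun θ hθ => ?_
    have hs : 0 < Real.sin θ := Real.sin_pos_of_mem_Ioo hθ
    have hu : 0 ≤ 1 - Real.cos θ := by linarith [Real.cos_le_one θ]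
    have hw : 0 < (x - y) ^ 2 + t ^ 2 + 2 * x * y * (1 - Real.cos θ) := by positivity
    have htw : t ^ 2 ≤ (x - y) ^ 2 + t ^ 2 + 2 * x * y * (1 - Real.cos θ) := by
      nlinarith [mul_nonneg hc hu, sq_nonneg (x - y)]
    rw [show l + 2 = (l + 1) + 1 by ring, Real.rpow_add hw, Real.rpow_one, ← mul_div_assoc,
      div_le_div_iff₀ (by positivity) (by positivity)]
    have p2 : 0 ≤ Real.sin θ ^ (2 * l - 1) *
      ((x - y) ^ 2 + t ^ 2 + 2 * x * y * (1 - Real.cos θ)) ^ (l + 1) := by positivity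
    nlinarith [mul_le_mul_of_nonneg_left htw p2]
  set I := ∫ θ in (0:ℝ)..π, Real.sin θ ^ (2 * l - 1) /
      ((x - y) ^ 2 + t ^ 2 + 2 * x * y * (1 - Real.cos θ)) ^ (l + 1)
  set J := ∫ θ in (0:ℝ)..π, Real.sin θ ^ (2 * l - 1) /
      ((x - y) ^ 2 + t ^ 2 + 2 * x * y * (1 - Real.cos θ)) ^ (l + 2)
  have K0 : 0 ≤ 2 * l / π * (x * y) ^ l := by positivity
  have e1 : 2 * l * (x * y) ^ l / π * I + 2 * l * (x * y) ^ l * t / π * (-(2 * (l + 1) * t) * J) =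
      2 * l / π * (x * y) ^ l * (I - 2 * (l + 1) * (t ^ 2 * J)) := by ring
  have e2 : 2 * l / π * (2 * l + 3) * ((x * y) ^ l * I) =
      2 * l / π * (x * y) ^ l * ((2 * l + 3) * I) := by ring
  rw [e1, e2, abs_mul, abs_of_nonneg K0]
  refine mul_le_mul_of_nonneg_left ?_ K0
  have q : 0 ≤ t ^ 2 * J := by positivity
  have q2 := mul_le_mul_of_nonneg_left hJI (by positivity : 0 ≤ 2 * (l + 1))
  have q3 : 0 ≤ 2 * (l + 1) * (t ^ 2 * J) := by positivity
  have q4 : 0 ≤ l * I := by positivity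
  rw [abs_le]
  constructor <;> nlinarith

/-- Bounds for the `t`-derivative of the Bessel–Poisson kernel:
`|∂_t P_t^λ(x,y)| ≤ C (xy)^λ/((x-y)²+t²)^{λ+1}` and `|∂_t P_t^λ(x,y)| ≤ C/((x-y)²+t²)`. -/
theorem statement4 (l : ℝ) (hl : 0 < l) :
    ∃ C > 0, ∀ x y t : ℝ, 0 < x → 0 < y → 0 < t →
      |deriv (fun s => besselPoissonKernel l x y s) t|
          ≤ C * (x * y) ^ l / ((x - y) ^ 2 + t ^ 2) ^ (l + 1) ∧
      |deriv (fun s => besselPoissonKernel l x y s) t| ≤ C / ((x - y) ^ 2 + t ^ 2) := by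
  have hM0 : 0 ≤ ∫ θ in (0:ℝ)..π, Real.sin θ ^ (2 * l - 1) := by
    refine intervalIntegral.integral_nonneg pi_pos.le fun θ hθ => ?_
    exact Real.rpow_nonneg (Real.sin_nonneg_of_nonneg_of_le_pi hθ.1 hθ.2) _
  refine ⟨2 * l / π * (2 * l + 3) * (2 ^ l / l + ∫ θ in (0:ℝ)..π, Real.sin θ ^ (2 * l - 1)),
    by positivity, fun x y t hx hy ht => ?_⟩
  have hA : 0 < (x - y) ^ 2 + t ^ 2 := by positivity
  have hc : 0 < 2 * x * y := by positivity
  have hd := ker_deriv_bound l x y t hl hx hy ht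
  have b1 := ker_bound1 l _ _ hl hA hc.le
  have b2 := ker_bound2 l _ _ hl hA hc
  have I0 : 0 ≤ ∫ θ in (0:ℝ)..π, Real.sin θ ^ (2 * l - 1) /
      ((x - y) ^ 2 + t ^ 2 + 2 * x * y * (1 - Real.cos θ)) ^ (l + 1) := by
    refine intervalIntegral.integral_nonneg pi_pos.le fun θ hθ => ?_
    have hsin : 0 ≤ Real.sin θ := Real.sin_nonneg_of_nonneg_of_le_pi hθ.1 hθ.2
    have hu : 0 ≤ 1 - Real.cos θ := by linarith [Real.cos_le_one θ]
    positivity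
  set I := ∫ θ in (0:ℝ)..π, Real.sin θ ^ (2 * l - 1) /
      ((x - y) ^ 2 + t ^ 2 + 2 * x * y * (1 - Real.cos θ)) ^ (l + 1)
  set M := ∫ θ in (0:ℝ)..π, Real.sin θ ^ (2 * l - 1)
  set A := (x - y) ^ 2 + t ^ 2
  have hK : 0 ≤ 2 * l / π * (2 * l + 3) := by positivity
  constructor
  · refine hd.trans ?_
    have : (x * y) ^ l * I ≤ (x * y) ^ l * ((2 ^ l / l + M) / A ^ (l + 1)) := by
      refine mul_le_mul_of_nonneg_left (b1.trans ?_) (by positivity)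
      gcongr
      exact le_add_of_nonneg_left (by positivity)
    refine (mul_le_mul_of_nonneg_left this hK).trans (le_of_eq (by ring))
  · refine hd.trans ?_
    have : (x * y) ^ l * I ≤ (2 ^ l / l + M) / A := by
      refine le_trans ?_ b2
      refine mul_le_mul_of_nonneg_right ?_ I0
      exact Real.rpow_le_rpow (by positivity) (by nlinarith [mul_pos hx hy]) hl.le
    refine (mul_le_mul_of_nonneg_left this hK).trans (le_of_eq (by ring))
end

section
/- Let λ > 0 and let a be an odd-atom supported in (0,α): either a = δ⁻¹ χ_{(0,δ)} for some δ > 0, or a is supported in a bounded interval I ⊂ (0,∞) with ∫_I a = 0 and ‖a‖_∞ ≤ |I|⁻¹. Then for each t > 0 there is C > 0 (independent of z) such that ∫₀^∞ |t ∂_t P_t^λ(y,z) · ∂_t P_t^λ(a)(y)| dy ≤ C z^λ / (1+z²)^{λ+1} for all z ∈ (0,∞). -/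
open MeasureTheory Real Set

/-- An odd-atom: either `δ⁻¹ χ_{(0,δ)}`, or supported in a bounded interval
`I ⊂ (0,∞)` with vanishing integral and `‖a‖_∞ ≤ |I|⁻¹`. -/
def IsOddAtom (a : ℝ → ℝ) : Prop :=
  (∃ δ : ℝ, 0 < δ ∧ ∀ x, a x = if x ∈ Set.Ioo 0 δ then δ⁻¹ else 0) ∨
  (∃ c d : ℝ, 0 ≤ c ∧ c < d ∧ (∀ x, x ∉ Set.Ioo c d → a x = 0) ∧
    (∫ x in Set.Ioo c d, a x) = 0 ∧ ∀ x, |a x| ≤ (d - c)⁻¹)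


/-- The angular integral. -/
noncomputable def bJ (l A k : ℝ) : ℝ :=
  ∫ θ in (0:ℝ)..π, Real.sin θ ^ (2 * l - 1) / (A + 2 * k * (1 - Real.cos θ)) ^ (l + 1)

lemma kernel_eq (l x y t : ℝ) : besselPoissonKernel l x y t =
    2 * l * (x * y) ^ l * t / π * bJ l ((x - y) ^ 2 + t ^ 2) (x * y) := by
  unfold besselPoissonKernel bJ
  simp only [mul_assoc]

lemma sin_rpow_int (p : ℝ) (hp : -1 < p) :
    IntervalIntegrable (fun θ => Real.sin θ ^ p) volume 0 π := by
  rcases le_or_gt 0 p with h | h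
  · exact (Real.continuous_sin.rpow_const (fun _ => Or.inr h)).intervalIntegrable _ _
  · have h1 : IntervalIntegrable (fun θ => Real.sin θ ^ p) volume 0 (π / 2) := by
      have := (intervalIntegral.intervalIntegrable_rpow' (a := 0) (b := π / 2) hp).const_mul
        ((2 / π) ^ p)
      refine this.mono_fun' (Real.measurable_sin.pow_const p).aestronglyMeasurable ?_
      rw [uIoc_of_le (by positivity)]
      refine (ae_restrict_iff' measurableSet_Ioc).2 (Filter.Eventually.of_forall fun x hx => ?_)
      have hs := Real.mul_le_sin hx.1.le hx.2
      have h0 : 0 < 2 / π * x := mul_pos (by positivity) hx.1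
      beta_reduce
      rw [Real.norm_of_nonneg (Real.rpow_nonneg (h0.le.trans hs) _),
        ← Real.mul_rpow (by positivity) hx.1.le]
      exact Real.rpow_le_rpow_of_nonpos h0 hs h.le
    have h2 := h1.comp_sub_left π
    simp only [Real.sin_pi_sub, sub_zero] at h2
    rw [show π - π / 2 = π / 2 by ring] at h2
    exact h1.trans h2.symm

lemma D_ge {A k : ℝ} (hk : 0 ≤ k) (θ : ℝ) : A ≤ A + 2 * k * (1 - Real.cos θ) := by
  have := Real.cos_le_one θ
  have : 0 ≤ 2 * k * (1 - Real.cos θ) := mul_nonneg (by positivity) (by linarith)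
  linarith

lemma D_cont {l A k : ℝ} (hA : 0 < A) (hk : 0 ≤ k) :
    Continuous (fun θ => ((A + 2 * k * (1 - Real.cos θ)) ^ (l + 1))⁻¹) := by
  have h : ∀ θ, 0 < A + 2 * k * (1 - Real.cos θ) := fun θ => hA.trans_le (D_ge hk θ)
  refine Continuous.inv₀ (Continuous.rpow_const (by fun_prop) fun θ => Or.inl (h θ).ne') ?_
  intro θ
  exact (Real.rpow_pos_of_pos (h θ) _).ne'

lemma bJ_int {l A k : ℝ} (hl : 0 < l) (hA : 0 < A) (hk : 0 ≤ k) :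
    IntervalIntegrable (fun θ => Real.sin θ ^ (2 * l - 1) /
      (A + 2 * k * (1 - Real.cos θ)) ^ (l + 1)) volume 0 π := by
  simp only [div_eq_mul_inv]
  exact (sin_rpow_int _ (by linarith)).mul_continuousOn (D_cont hA hk).continuousOn

lemma bJ_pos {l A k : ℝ} (hl : 0 < l) (hA : 0 < A) (hk : 0 ≤ k) : 0 < bJ l A k := by
  refine intervalIntegral.intervalIntegral_pos_of_pos_on (bJ_int hl hA hk) ?_ Real.pi_pos
  intro θ hθ
  exact div_pos (Real.rpow_pos_of_pos (Real.sin_pos_of_mem_Ioo hθ) _)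
    (Real.rpow_pos_of_pos (hA.trans_le (D_ge hk θ)) _)

lemma bJ_le1 {l A k : ℝ} (hl : 0 < l) (hA : 0 < A) (hk : 0 ≤ k) :
    bJ l A k ≤ (∫ θ in (0:ℝ)..π, Real.sin θ ^ (2 * l - 1)) / A ^ (l + 1) := by
  rw [← intervalIntegral.integral_div]
  refine intervalIntegral.integral_mono_on Real.pi_pos.le (bJ_int hl hA hk)
    ((sin_rpow_int _ (by linarith)).div_const _) ?_
  intro θ hθ
  have := Real.rpow_nonneg (Real.sin_nonneg_of_mem_Icc hθ) (2 * l - 1)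
  have := Real.rpow_pos_of_pos hA (l + 1)
  have := D_ge (A := A) hk θ
  gcongr

lemma sinS_pos {l : ℝ} (hl : 0 < l) : 0 < ∫ θ in (0:ℝ)..π, Real.sin θ ^ (2 * l - 1) := by
  refine intervalIntegral.intervalIntegral_pos_of_pos_on (sin_rpow_int _ (by linarith)) ?_ Real.pi_pos
  intro θ hθ
  exact Real.rpow_pos_of_pos (Real.sin_pos_of_mem_Ioo hθ) _

/-- Second half of the angular integral. -/
lemma bJ_half2 {l A k : ℝ} (hl : 0 < l) (hA : 0 < A) (hk : 0 < k) :
    (∫ θ in (π/2)..π, Real.sin θ ^ (2 * l - 1) / (A + 2 * k * (1 - Real.cos θ)) ^ (l + 1))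
      ≤ (∫ θ in (π/2)..π, Real.sin θ ^ (2 * l - 1)) / (A * k ^ l) := by
  have hpi := Real.pi_pos
  have hsub : uIcc (π/2) π ⊆ uIcc 0 π := by
    rw [uIcc_of_le (by linarith), uIcc_of_le (by linarith)]
    exact Icc_subset_Icc (by linarith) le_rfl
  rw [← intervalIntegral.integral_div]
  refine intervalIntegral.integral_mono_on (by linarith) ((bJ_int hl hA hk.le).mono_set hsub)
    (((sin_rpow_int _ (by linarith)).mono_set hsub).div_const _) ?_
  intro θ hθ
  have h1 := Real.rpow_nonneg (Real.sin_nonneg_of_mem_Icc ⟨by linarith [hθ.1], hθ.2⟩) (2 * l - 1)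
  have hc : Real.cos θ ≤ 0 := Real.cos_nonpos_of_pi_div_two_le_of_le hθ.1 (by linarith [hθ.2])
  have h3 : A + k ≤ A + 2 * k * (1 - Real.cos θ) := by nlinarith
  have hD : 0 < A + 2 * k * (1 - Real.cos θ) := by linarith
  have h4 : k ^ l ≤ (A + 2 * k * (1 - Real.cos θ)) ^ l :=
    Real.rpow_le_rpow hk.le (by linarith) hl.le
  have h5 := Real.rpow_pos_of_pos hk l
  have h6 : A * k ^ l ≤ (A + 2 * k * (1 - Real.cos θ)) ^ (l + 1) := by
    rw [Real.rpow_add_one hD.ne', mul_comm]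
    exact mul_le_mul h4 (by linarith) hA.le (h5.le.trans h4)
  exact div_le_div_of_nonneg_left h1 (by positivity) h6

/-- First half of the angular integral. -/
lemma bJ_half1 {l A k : ℝ} (hl : 0 < l) (hA : 0 < A) (hk : 0 < k) :
    (∫ θ in (0:ℝ)..(π/2), Real.sin θ ^ (2 * l - 1) / (A + 2 * k * (1 - Real.cos θ)) ^ (l + 1))
      ≤ (2 ^ (2 * l) / l) / (A * k ^ l) := by
  have hpi := Real.pi_pos
  have hsub : uIcc 0 (π/2) ⊆ uIcc 0 π := by
    rw [uIcc_of_le (by linarith), uIcc_of_le (by linarith)]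
    exact Icc_subset_Icc le_rfl (by linarith)
  have hDpos : ∀ s : ℝ, 0 < A + 4 * k * s ^ 2 := fun s => by positivity
  have hDeq : ∀ θ, A + 2 * k * (1 - Real.cos θ) = A + 4 * k * Real.sin (θ/2) ^ 2 := fun θ => by
    rw [show Real.cos θ = Real.cos (2 * (θ/2)) by ring_nf, Real.cos_two_mul, Real.cos_sq']
    ring
  set G : ℝ → ℝ := fun θ => (Real.sin (θ/2)) ^ (2 * l) * (A + 4 * k * Real.sin (θ/2) ^ 2) ^ (-l)
  set G' : ℝ → ℝ := fun θ => l * A * Real.sin (θ/2) ^ (2 * l - 1) * Real.cos (θ/2) *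
    (A + 4 * k * Real.sin (θ/2) ^ 2) ^ (-(l+1))
  have hcont : Continuous G := by
    refine Continuous.mul (Continuous.rpow_const (by fun_prop) fun _ => Or.inr (by linarith)) ?_
    exact Continuous.rpow_const (by fun_prop) fun θ => Or.inl (hDpos _).ne'
  have hs : ∀ θ ∈ Ioo 0 (π/2), 0 < Real.sin (θ/2) := fun θ hθ =>
    Real.sin_pos_of_pos_of_lt_pi (by linarith [hθ.1]) (by linarith [hθ.2])
  have hc : ∀ θ ∈ Ioo 0 (π/2), 0 < Real.cos (θ/2) := fun θ hθ =>
    Real.cos_pos_of_mem_Ioo ⟨by linarith [hθ.1], by linarith [hθ.2]⟩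
  have hder : ∀ θ ∈ Ioo 0 (π/2), HasDerivAt G (G' θ) θ := by
    intro θ hθ
    have hsd : HasDerivAt (fun θ : ℝ => Real.sin (θ/2)) (Real.cos (θ/2) * (1/2)) θ :=
      ((hasDerivAt_id θ).div_const 2).sin
    have e1 := hsd.rpow_const (p := 2 * l) (Or.inl (hs θ hθ).ne')
    have e2 := (((hsd.pow 2).const_mul (4 * k)).const_add A).rpow_const (p := -l)
      (Or.inl (hDpos _).ne')
    refine HasDerivAt.congr_deriv (f := G) (e1.mul e2) ?_
    simp only [G', Pi.pow_apply]
    have hp := hDpos (Real.sin (θ/2))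
    have hs' := hs θ hθ
    rw [show -(l+1) = -l - 1 by ring, Real.rpow_sub_one hs'.ne', Real.rpow_sub_one hp.ne',
       ]
    field_simp
    push_cast
    ring
  have hG'nn : ∀ θ ∈ Ioo 0 (π/2), 0 ≤ G' θ := fun θ hθ => by
    have := hs θ hθ
    have := hc θ hθ
    have := hDpos (Real.sin (θ/2))
    simp only [G']
    positivity
  have hle : (0:ℝ) ≤ π/2 := by positivity
  have hint : IntervalIntegrable G' volume 0 (π/2) := by
    apply intervalIntegral.intervalIntegrable_deriv_of_nonneg hcont.continuousOn
    · rwa [min_eq_left hle, max_eq_right hle]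
    · rwa [min_eq_left hle, max_eq_right hle]
  have hval := intervalIntegral.integral_eq_sub_of_hasDerivAt_of_le hle hcont.continuousOn hder hint
  have hG0 : G 0 = 0 := by
    simp only [G]
    simp [Real.zero_rpow (show 2 * l ≠ 0 by linarith)]
  have hkl := Real.rpow_pos_of_pos hk l
  have hG1 : G (π/2) ≤ 1 / k ^ l := by
    simp only [G]
    have hs1 : 0 < Real.sin (π/2/2) := Real.sin_pos_of_pos_of_lt_pi (by linarith) (by linarith)
    set s := Real.sin (π/2/2)
    rw [Real.rpow_neg (hDpos _).le, ← div_eq_mul_inv, div_le_div_iff₀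
      (Real.rpow_pos_of_pos (hDpos _) _) hkl, one_mul, Real.rpow_mul hs1.le,
      ← Real.mul_rpow (by positivity) hk.le]
    refine Real.rpow_le_rpow (by positivity) ?_ hl.le
    rw [Real.rpow_two]
    nlinarith [mul_pos hk (pow_pos hs1 2)]
  have hmono : (∫ θ in (0:ℝ)..(π/2), Real.sin θ ^ (2 * l - 1) /
      (A + 2 * k * (1 - Real.cos θ)) ^ (l + 1)) ≤
      ∫ θ in (0:ℝ)..(π/2), (2 ^ (2 * l) / (l * A)) * G' θ := by
    refine intervalIntegral.integral_mono_on_of_le_Ioo hle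
      ((bJ_int hl hA hk.le).mono_set hsub) (hint.const_mul _) ?_
    intro θ hθ
    have hs' := hs θ hθ
    have hc' := hc θ hθ
    have hp := hDpos (Real.sin (θ/2))
    have hsin : Real.sin θ = 2 * Real.sin (θ/2) * Real.cos (θ/2) := by
      rw [← Real.sin_two_mul]; ring_nf
    have hc2 : 1/2 ≤ Real.cos (θ/2) ^ 2 := by
      have : Real.cos θ = 2 * Real.cos (θ/2) ^ 2 - 1 := by
        rw [← Real.cos_two_mul]; ring_nf
      have : 0 ≤ Real.cos θ := Real.cos_nonneg_of_mem_Icc ⟨by linarith [hθ.1], hθ.2.le⟩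
      linarith
    have hc1 : Real.cos (θ/2) ≤ 1 := Real.cos_le_one _
    rw [hDeq, hsin]
    simp only [G']
    set s := Real.sin (θ/2)
    set c := Real.cos (θ/2)
    rw [Real.mul_rpow (by positivity) hc'.le, Real.mul_rpow (by norm_num) hs'.le,
      Real.rpow_neg hp.le, Real.rpow_sub_one (two_ne_zero), Real.rpow_sub_one hc'.ne']
    have h2l := Real.rpow_pos_of_pos (two_pos (α := ℝ)) (2 * l)
    have hsl := Real.rpow_pos_of_pos hs' (2 * l - 1)
    have hDl := Real.rpow_pos_of_pos hp (l + 1)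
    have hcl : c ^ (2 * l) ≤ 1 := Real.rpow_le_one hc'.le hc1 (by linarith)
    have key : c ^ (2 * l) / c ≤ 2 * c := by
      rw [div_le_iff₀ hc']; nlinarith
    calc _ = (2 ^ (2 * l) / 2 * s ^ (2 * l - 1) / (A + 4 * k * s ^ 2) ^ (l + 1)) *
          (c ^ (2 * l) / c) := by ring
      _ ≤ (2 ^ (2 * l) / 2 * s ^ (2 * l - 1) / (A + 4 * k * s ^ 2) ^ (l + 1)) * (2 * c) :=
          mul_le_mul_of_nonneg_left key (by positivity)
      _ = _ := by field_simp
  rw [intervalIntegral.integral_const_mul, hval, hG0, sub_zero] at hmono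
  refine hmono.trans ?_
  have h2l := Real.rpow_pos_of_pos (two_pos (α := ℝ)) (2 * l)
  calc _ ≤ (2 ^ (2 * l) / (l * A)) * (1 / k ^ l) := mul_le_mul_of_nonneg_left hG1 (by positivity)
    _ = _ := by field_simp

lemma bJ_le2 {l : ℝ} (hl : 0 < l) : ∃ C > 0, ∀ A k : ℝ, 0 < A → 0 < k →
    k ^ l * bJ l A k ≤ C / A := by
  have hpi := Real.pi_pos
  have hn : 0 ≤ ∫ θ in (π/2)..π, Real.sin θ ^ (2 * l - 1) := by
    refine intervalIntegral.integral_nonneg (by linarith) fun θ hθ => ?_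
    exact Real.rpow_nonneg (Real.sin_nonneg_of_mem_Icc ⟨by linarith [hθ.1], hθ.2⟩) _
  refine ⟨2 ^ (2 * l) / l + ∫ θ in (π/2)..π, Real.sin θ ^ (2 * l - 1), by positivity, ?_⟩
  intro A k hA hk
  have hkl := Real.rpow_pos_of_pos hk l
  have hi := bJ_int hl hA hk.le
  have hsplit := intervalIntegral.integral_add_adjacent_intervals
    (hi.mono_set (c := 0) (d := π/2) (by
      rw [uIcc_of_le (by linarith), uIcc_of_le (by linarith)]
      exact Icc_subset_Icc le_rfl (by linarith)))
    (hi.mono_set (c := π/2) (d := π) (by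
      rw [uIcc_of_le (by linarith), uIcc_of_le (by linarith)]
      exact Icc_subset_Icc (by linarith) le_rfl))
  have h1 := bJ_half1 hl hA hk
  have h2 := bJ_half2 hl hA hk
  have h3 : bJ l A k ≤ (2 ^ (2 * l) / l + ∫ θ in (π/2)..π, Real.sin θ ^ (2 * l - 1)) /
      (A * k ^ l) := by
    unfold bJ
    rw [← hsplit, add_div]
    exact add_le_add h1 h2
  calc _ ≤ k ^ l * _ := mul_le_mul_of_nonneg_left h3 hkl.le
    _ = _ := by field_simp

lemma lip_scalar {l Q τ s t : ℝ} (hl : 0 < l) (hQ : 0 ≤ Q) (hτ : 0 < τ) (hs : τ ≤ s) (ht : τ ≤ t) :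
    |s / (Q + s ^ 2) ^ (l + 1) - t / (Q + t ^ 2) ^ (l + 1)| ≤
      (2 * l + 3) / (Q + τ ^ 2) ^ (l + 1) * |s - t| := by
  have hpos : ∀ u ∈ Ici τ, 0 < Q + u ^ 2 := fun u hu => by
    have : 0 < u := hτ.trans_le hu
    positivity
  have hd : ∀ u ∈ Ici τ, HasDerivWithinAt (fun u : ℝ => u * (Q + u ^ 2) ^ (-(l + 1)))
      (1 * (Q + u ^ 2) ^ (-(l + 1)) +
        u * ((2 * u) * (-(l + 1)) * (Q + u ^ 2) ^ (-(l + 1) - 1))) (Ici τ) u := by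
    intro u hu
    have e : HasDerivAt (fun u : ℝ => Q + u ^ 2) (2 * u) u := by
      simpa using (hasDerivAt_pow 2 u).const_add Q
    exact ((hasDerivAt_id u).mul (e.rpow_const (p := -(l + 1))
      (Or.inl (hpos u hu).ne'))).hasDerivWithinAt
  have hb : ∀ u ∈ Ici τ, ‖1 * (Q + u ^ 2) ^ (-(l + 1)) +
        u * ((2 * u) * (-(l + 1)) * (Q + u ^ 2) ^ (-(l + 1) - 1))‖ ≤
        (2 * l + 3) / (Q + τ ^ 2) ^ (l + 1) := by
    intro u hu
    have hp := hpos u hu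
    have hu0 : 0 < u := hτ.trans_le hu
    have hR := Real.rpow_pos_of_pos hp (-(l + 1))
    have h0 : 0 < Q + τ ^ 2 := by positivity
    have hfrac : 0 ≤ u ^ 2 / (Q + u ^ 2) := by positivity
    have hfrac1 : u ^ 2 / (Q + u ^ 2) ≤ 1 := by rw [div_le_one hp]; linarith
    have hle : (Q + u ^ 2) ^ (-(l + 1)) ≤ ((Q + τ ^ 2) ^ (l + 1))⁻¹ := by
      rw [← Real.rpow_neg h0.le]
      refine Real.rpow_le_rpow_of_nonpos h0 ?_ (by linarith)
      have : τ ^ 2 ≤ u ^ 2 := pow_le_pow_left₀ hτ.le hu 2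
      linarith
    have e : 1 * (Q + u ^ 2) ^ (-(l + 1)) +
        u * ((2 * u) * (-(l + 1)) * (Q + u ^ 2) ^ (-(l + 1) - 1)) =
        (Q + u ^ 2) ^ (-(l + 1)) * (1 - 2 * (l + 1) * (u ^ 2 / (Q + u ^ 2))) := by
      rw [Real.rpow_sub_one hp.ne']
      field_simp
      ring
    rw [e, norm_mul, Real.norm_of_nonneg hR.le, div_eq_inv_mul (2 * l + 3), Real.norm_eq_abs]
    refine mul_le_mul hle ?_ (abs_nonneg _) (by positivity)
    rw [abs_le]
    constructor <;> nlinarith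
  have := Convex.norm_image_sub_le_of_norm_hasDerivWithin_le hd hb (convex_Ici τ) ht hs
  have e : ∀ u ∈ Ici τ, u / (Q + u ^ 2) ^ (l + 1) = u * (Q + u ^ 2) ^ (-(l + 1)) := fun u hu => by
    rw [Real.rpow_neg (hpos u hu).le, div_eq_mul_inv]
  rw [e s hs, e t ht]
  simpa [Real.norm_eq_abs] using this

lemma bJ_lip {l B k τ s t : ℝ} (hl : 0 < l) (hB : 0 ≤ B) (hk : 0 ≤ k) (hτ : 0 < τ)
    (hs : τ ≤ s) (ht : τ ≤ t) :
    |s * bJ l (B + s ^ 2) k - t * bJ l (B + t ^ 2) k| ≤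
      (2 * l + 3) * |s - t| * bJ l (B + τ ^ 2) k := by
  have hs0 : 0 < s := hτ.trans_le hs
  have ht0 : 0 < t := hτ.trans_le ht
  have is := bJ_int hl (show 0 < B + s ^ 2 by positivity) hk
  have it := bJ_int hl (show 0 < B + t ^ 2 by positivity) hk
  have iτ := bJ_int hl (show 0 < B + τ ^ 2 by positivity) hk
  unfold bJ
  rw [← intervalIntegral.integral_const_mul, ← intervalIntegral.integral_const_mul,
    ← intervalIntegral.integral_const_mul,
    ← intervalIntegral.integral_sub (is.const_mul _) (it.const_mul _), ← Real.norm_eq_abs]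
  refine intervalIntegral.norm_integral_le_of_norm_le Real.pi_pos.le
    (Filter.Eventually.of_forall fun θ hθ => ?_) (iτ.const_mul _)
  have hS := Real.rpow_nonneg (Real.sin_nonneg_of_mem_Icc ⟨hθ.1.le, hθ.2⟩) (2 * l - 1)
  have hQ : 0 ≤ B + 2 * k * (1 - Real.cos θ) := hB.trans (D_ge hk θ)
  have h := lip_scalar hl hQ hτ hs ht
  have e : ∀ u : ℝ, B + u ^ 2 + 2 * k * (1 - Real.cos θ) = B + 2 * k * (1 - Real.cos θ) + u ^ 2 :=
    fun u => by ring
  rw [e, e, e, Real.norm_eq_abs]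
  set Q := B + 2 * k * (1 - Real.cos θ)
  calc _ = |Real.sin θ ^ (2 * l - 1) *
        (s / (Q + s ^ 2) ^ (l + 1) - t / (Q + t ^ 2) ^ (l + 1))| := by congr 1; ring
    _ = Real.sin θ ^ (2 * l - 1) *
        |s / (Q + s ^ 2) ^ (l + 1) - t / (Q + t ^ 2) ^ (l + 1)| := by
          rw [abs_mul, abs_of_nonneg hS]
    _ ≤ _ := mul_le_mul_of_nonneg_left h hS
    _ = _ := by ring

/-- Lipschitz constant in time of the kernel. -/
noncomputable def bB (l τ x y : ℝ) : ℝ :=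
  2 * l * (2 * l + 3) / π * ((x * y) ^ l * bJ l ((x - y) ^ 2 + τ ^ 2) (x * y))

lemma kernel_lip {l x y τ s t : ℝ} (hl : 0 < l) (hx : 0 < x) (hy : 0 < y) (hτ : 0 < τ)
    (hs : τ ≤ s) (ht : τ ≤ t) :
    |besselPoissonKernel l x y s - besselPoissonKernel l x y t| ≤ bB l τ x y * |s - t| := by
  have hk := mul_pos hx hy
  have h := bJ_lip hl (sq_nonneg (x - y)) hk.le hτ hs ht
  have hkl := Real.rpow_pos_of_pos hk l
  have hpi := Real.pi_pos
  rw [kernel_eq, kernel_eq]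
  calc _ = |2 * l * (x * y) ^ l / π * (s * bJ l ((x - y) ^ 2 + s ^ 2) (x * y) -
        t * bJ l ((x - y) ^ 2 + t ^ 2) (x * y))| := by congr 1; ring
    _ = 2 * l * (x * y) ^ l / π * |s * bJ l ((x - y) ^ 2 + s ^ 2) (x * y) -
        t * bJ l ((x - y) ^ 2 + t ^ 2) (x * y)| := by
          rw [abs_mul, abs_of_pos (by positivity)]
    _ ≤ _ := mul_le_mul_of_nonneg_left h (by positivity)
    _ = _ := by unfold bB; ring

lemma bB_pos {l x y τ : ℝ} (hl : 0 < l) (hx : 0 < x) (hy : 0 < y) (hτ : 0 < τ) :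
    0 < bB l τ x y := by
  have hk := mul_pos hx hy
  have hkl := Real.rpow_pos_of_pos hk l
  have hpi := Real.pi_pos
  have := bJ_pos hl (show 0 < (x - y) ^ 2 + τ ^ 2 by positivity) hk.le
  unfold bB
  positivity

lemma bB_bounds {l : ℝ} (hl : 0 < l) : ∃ C > 0, ∀ τ x y : ℝ, 0 < τ → 0 < x → 0 < y →
    bB l τ x y ≤ C * ((x * y) ^ l / ((x - y) ^ 2 + τ ^ 2) ^ (l + 1)) ∧
    bB l τ x y ≤ C * (1 / ((x - y) ^ 2 + τ ^ 2)) := by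
  obtain ⟨C2, hC2, h2⟩ := bJ_le2 hl
  have hS := sinS_pos hl
  set S := ∫ θ in (0:ℝ)..π, Real.sin θ ^ (2 * l - 1) with hSd
  have hpi := Real.pi_pos
  have hc : 0 < 2 * l * (2 * l + 3) / π := by positivity
  refine ⟨2 * l * (2 * l + 3) / π * (S + C2), by positivity, fun τ x y hτ hx hy => ?_⟩
  have hk := mul_pos hx hy
  have hkl := Real.rpow_pos_of_pos hk l
  have hA : 0 < (x - y) ^ 2 + τ ^ 2 := by positivity
  have h1 := bJ_le1 hl hA hk.le
  rw [← hSd] at h1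
  have h2 := h2 _ _ hA hk
  have hAl := Real.rpow_pos_of_pos hA (l + 1)
  set A := (x - y) ^ 2 + τ ^ 2
  unfold bB
  constructor
  · rw [mul_assoc (2 * l * (2 * l + 3) / π)]
    refine mul_le_mul_of_nonneg_left ?_ hc.le
    calc _ ≤ (x * y) ^ l * (S / A ^ (l + 1)) := mul_le_mul_of_nonneg_left h1 hkl.le
      _ = S * ((x * y) ^ l / A ^ (l + 1)) := by ring
      _ ≤ _ := mul_le_mul_of_nonneg_right (by linarith) (by positivity)
  · rw [mul_assoc (2 * l * (2 * l + 3) / π)]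
    refine mul_le_mul_of_nonneg_left ?_ hc.le
    calc _ ≤ C2 / A := h2
      _ = C2 * (1 / A) := by ring
      _ ≤ _ := mul_le_mul_of_nonneg_right (by linarith) (by positivity)

lemma deriv_kernel_le {l x y t : ℝ} (hl : 0 < l) (hx : 0 < x) (hy : 0 < y) (ht : 0 < t) :
    |deriv (fun s => besselPoissonKernel l x y s) t| ≤ bB l (t / 2) x y := by
  rw [← Real.norm_eq_abs]
  refine norm_deriv_le_of_lip' (bB_pos hl hx hy (by linarith)).le ?_
  filter_upwards [Ioi_mem_nhds (show t / 2 < t by linarith)] with s hs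
  exact kernel_lip hl hx hy (by linarith) (le_of_lt hs) (by linarith)

lemma kernel_meas (l y s : ℝ) : Measurable (fun w => besselPoissonKernel l y w s) := by
  unfold besselPoissonKernel
  refine Measurable.mul (by fun_prop) ?_
  simp only [intervalIntegral.integral_of_le Real.pi_pos.le]
  refine StronglyMeasurable.measurable ?_
  refine StronglyMeasurable.integral_prod_right (f := fun w θ => Real.sin θ ^ (2 * l - 1) /
      ((y - w) ^ 2 + s ^ 2 + 2 * y * w * (1 - Real.cos θ)) ^ (l + 1)) ?_
  refine Measurable.stronglyMeasurable ?_
  unfold Function.uncurry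
  refine Measurable.div ?_ ?_
  · exact (Real.measurable_sin.comp measurable_snd).pow_const _
  · refine Measurable.pow_const ?_ _
    fun_prop

lemma kernel_pos {l x y t : ℝ} (hl : 0 < l) (hx : 0 < x) (hy : 0 < y) (ht : 0 < t) :
    0 < besselPoissonKernel l x y t := by
  rw [kernel_eq]
  have hk := mul_pos hx hy
  have hkl := Real.rpow_pos_of_pos hk l
  have hpi := Real.pi_pos
  have := bJ_pos hl (show 0 < (x - y) ^ 2 + t ^ 2 by positivity) hk.le
  positivity

/-- crude bound for integrability -/
lemma kernel_le {l x y t d : ℝ} (hl : 0 < l) (hx : 0 < x) (hy : 0 < y) (hyd : y < d) (ht : 0 < t) :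
    besselPoissonKernel l x y t ≤ 2 * l * (x * d) ^ l * t / π *
      ((∫ θ in (0:ℝ)..π, Real.sin θ ^ (2 * l - 1)) / (t ^ 2) ^ (l + 1)) := by
  rw [kernel_eq]
  have hk := mul_pos hx hy
  have hpi := Real.pi_pos
  have hA : 0 < (x - y) ^ 2 + t ^ 2 := by positivity
  have hS := sinS_pos hl
  have hd : 0 < d := hy.trans hyd
  have h1 := bJ_le1 hl hA hk.le
  have h2 : bJ l ((x - y) ^ 2 + t ^ 2) (x * y) ≤
      (∫ θ in (0:ℝ)..π, Real.sin θ ^ (2 * l - 1)) / (t ^ 2) ^ (l + 1) := by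
    refine h1.trans ?_
    have : t ^ 2 ≤ (x - y) ^ 2 + t ^ 2 := by nlinarith [sq_nonneg (x - y)]
    exact div_le_div_of_nonneg_left hS.le (by positivity)
      (Real.rpow_le_rpow (by positivity) this (by linarith))
  refine mul_le_mul ?_ h2 (bJ_pos hl hA hk.le).le (by positivity)
  gcongr

lemma atom_bdd {a : ℝ → ℝ} (ha : IsOddAtom a) : ∃ d > 0, ∃ M > 0,
    (∀ x, x ∉ Ioo 0 d → a x = 0) ∧ ∀ x, |a x| ≤ M := by
  rcases ha with ⟨δ, hδ, h⟩ | ⟨c, d, hc, hcd, hs, -, hb⟩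
  · refine ⟨δ, hδ, δ⁻¹, by positivity, fun x hx => by rw [h, if_neg hx], fun x => ?_⟩
    rw [h]
    split_ifs
    · rw [abs_of_pos (by positivity)]
    · simpa using hδ.le
  · refine ⟨d, by linarith, (d - c)⁻¹, inv_pos.2 (by linarith), fun x hx => hs x fun hx' => hx ?_, hb⟩
    exact ⟨by linarith [hx'.1], hx'.2⟩

lemma deriv_Pa_le {l t : ℝ} (hl : 0 < l) (ht : 0 < t) {a : ℝ → ℝ} (ha : IsOddAtom a) :
    ∃ C > 0, ∀ y : ℝ, 0 < y →
      |deriv (fun s => ∫ w in Ioi (0:ℝ), besselPoissonKernel l y w s * a w) t| ≤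
        C * (y ^ l / (1 + y ^ 2) ^ (l + 1)) := by
  obtain ⟨d, hd, M, hM, hsupp, hbd⟩ := atom_bdd ha
  obtain ⟨C1, hC1, hB⟩ := bB_bounds hl
  have hτ : 0 < t / 2 := by linarith
  obtain ⟨K, hK, hKb⟩ : ∃ K > 0, ∀ y w : ℝ, w ∈ Ioo 0 d →
      1 + y ^ 2 ≤ K * ((y - w) ^ 2 + (t / 2) ^ 2) := by
    refine ⟨2 + (2 * d ^ 2 + 1) / (t / 2) ^ 2, by positivity, fun y w hw => ?_⟩
    have e : (2 + (2 * d ^ 2 + 1) / (t / 2) ^ 2) * ((y - w) ^ 2 + (t / 2) ^ 2) =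
      2 * (y - w) ^ 2 + 2 * (t / 2) ^ 2 + (2 * d ^ 2 + 1) +
        (2 * d ^ 2 + 1) / (t / 2) ^ 2 * (y - w) ^ 2 := by field_simp; ring
    rw [e]
    have : 0 ≤ (2 * d ^ 2 + 1) / (t / 2) ^ 2 * (y - w) ^ 2 := by positivity
    have : w ^ 2 ≤ d ^ 2 := pow_le_pow_left₀ hw.1.le hw.2.le 2
    nlinarith [sq_nonneg (y - 2 * w), sq_nonneg t]
  refine ⟨d * (C1 * d ^ l * K ^ (l + 1) * M), by positivity, fun y hy => ?_⟩
  set E : ℝ := C1 * d ^ l * K ^ (l + 1) * M * (y ^ l / (1 + y ^ 2) ^ (l + 1)) with hE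
  have hE0 : 0 < E := by positivity
  have hBE : ∀ w ∈ Ioo 0 d, bB l (t / 2) y w * |a w| ≤ E := by
    intro w hw
    have hA : 0 < (y - w) ^ 2 + (t / 2) ^ 2 := by positivity
    have h1 := (hB (t / 2) y w hτ hy hw.1).1
    have h2 : (1 + y ^ 2) ^ (l + 1) ≤ K ^ (l + 1) * ((y - w) ^ 2 + (t / 2) ^ 2) ^ (l + 1) := by
      rw [← Real.mul_rpow hK.le hA.le]
      exact Real.rpow_le_rpow (by positivity) (hKb y w hw) (by linarith)
    have h3 : (y * w) ^ l ≤ y ^ l * d ^ l := by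
      rw [← Real.mul_rpow hy.le hd.le]
      exact Real.rpow_le_rpow (mul_pos hy hw.1).le
        (mul_le_mul_of_nonneg_left hw.2.le hy.le) hl.le
    have hAl := Real.rpow_pos_of_pos hA (l + 1)
    have hYl : 0 < (1 + y ^ 2) ^ (l + 1) := by positivity
    have h4 : (y * w) ^ l / ((y - w) ^ 2 + (t / 2) ^ 2) ^ (l + 1) ≤
        y ^ l * d ^ l * K ^ (l + 1) / (1 + y ^ 2) ^ (l + 1) := by
      rw [div_le_div_iff₀ hAl hYl]
      calc _ ≤ (y ^ l * d ^ l) * (K ^ (l + 1) * ((y - w) ^ 2 + (t / 2) ^ 2) ^ (l + 1)) :=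
            mul_le_mul h3 h2 hYl.le (by positivity)
        _ = _ := by ring
    calc _ ≤ (C1 * (y ^ l * d ^ l * K ^ (l + 1) / (1 + y ^ 2) ^ (l + 1))) * M :=
          mul_le_mul (h1.trans (mul_le_mul_of_nonneg_left h4 hC1.le)) (hbd w) (abs_nonneg _)
            (by positivity)
      _ = _ := by rw [hE]; ring
  have hgint : ∀ c : ℝ, Integrable ((Ioo 0 d).indicator fun _ => c) (volume.restrict (Ioi 0)) := by
    intro c
    refine Integrable.restrict ?_
    rw [integrable_indicator_iff measurableSet_Ioo]
    exact integrableOn_const (by simp)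
  have hgval : ∀ c : ℝ, ∫ w in Ioi (0:ℝ), (Ioo 0 d).indicator (fun _ => c) w = d * c := by
    intro c
    rw [setIntegral_indicator measurableSet_Ioo,
      inter_eq_right.2 (Ioo_subset_Ioi_self : Ioo 0 d ⊆ Ioi 0)]
    simp [hd.le]
  have hfin : d * (C1 * d ^ l * K ^ (l + 1) * M) * (y ^ l / (1 + y ^ 2) ^ (l + 1)) = d * E := by
    rw [hE]; ring
  rw [hfin, ← Real.norm_eq_abs]
  refine norm_deriv_le_of_lip' (by positivity) ?_
  filter_upwards [Ioi_mem_nhds (show t / 2 < t by linarith)] with s hs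
  have hs0 : 0 < s := hτ.trans hs
  by_cases hm : AEStronglyMeasurable a (volume.restrict (Ioi 0))
  · have hint : ∀ u : ℝ, 0 < u →
        Integrable (fun w => besselPoissonKernel l y w u * a w) (volume.restrict (Ioi 0)) := by
      intro u hu
      refine (hgint (2 * l * (y * d) ^ l * u / π *
        ((∫ θ in (0:ℝ)..π, Real.sin θ ^ (2 * l - 1)) / (u ^ 2) ^ (l + 1)) * M)).mono'
        ((kernel_meas l y u).aestronglyMeasurable.mul hm) ?_
      refine (ae_restrict_iff' measurableSet_Ioi).2 (Filter.Eventually.of_forall fun w hw => ?_)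
      by_cases hwd : w ∈ Ioo 0 d
      · rw [indicator_of_mem hwd, norm_mul, Real.norm_eq_abs, Real.norm_eq_abs,
          abs_of_pos (kernel_pos hl hy hw hu)]
        have hle := kernel_le hl hy hw hwd.2 hu
        exact mul_le_mul hle (hbd w) (abs_nonneg _) ((kernel_pos hl hy hw hu).le.trans hle)
      · rw [indicator_of_notMem hwd, hsupp w hwd]
        simp
    rw [← integral_sub (hint s hs0) (hint t ht)]
    have := norm_integral_le_of_norm_le (f := fun w => besselPoissonKernel l y w s * a w -
      besselPoissonKernel l y w t * a w) (hgint (E * |s - t|)) (by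
      refine (ae_restrict_iff' measurableSet_Ioi).2 (Filter.Eventually.of_forall fun w hw => ?_)
      by_cases hwd : w ∈ Ioo 0 d
      · rw [indicator_of_mem hwd, ← sub_mul, norm_mul, Real.norm_eq_abs, Real.norm_eq_abs]
        have h := kernel_lip hl hy hw hτ (le_of_lt hs) (show t / 2 ≤ t by linarith)
        calc _ ≤ (bB l (t / 2) y w * |s - t|) * |a w| :=
              mul_le_mul_of_nonneg_right h (abs_nonneg _)
          _ = (bB l (t / 2) y w * |a w|) * |s - t| := by ring
          _ ≤ _ := mul_le_mul_of_nonneg_right (hBE w hwd) (abs_nonneg _)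
      · rw [indicator_of_notMem hwd, hsupp w hwd]
        simp)
    rw [hgval] at this
    rw [Real.norm_eq_abs (s - t), mul_assoc]
    exact this
  · have hz : ∀ u : ℝ, 0 < u → ∫ w in Ioi (0:ℝ), besselPoissonKernel l y w u * a w = 0 := by
      intro u hu
      refine integral_undef fun hi => hm ?_
      have := ((kernel_meas l y u).inv.aestronglyMeasurable
        (μ := volume.restrict (Ioi (0:ℝ)))).mul hi.aestronglyMeasurable
      refine this.congr ?_
      refine (ae_restrict_iff' measurableSet_Ioi).2 (Filter.Eventually.of_forall fun w hw => ?_)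
      have := kernel_pos hl hy hw hu
      simp only [Pi.mul_apply, Pi.inv_apply]
      field_simp
    rw [hz s hs0, hz t ht]
    simp only [sub_self, norm_zero]
    positivity

lemma pointwise_bound {l t C1 C3 : ℝ} (hl : 0 < l) (ht : 0 < t) (hC1 : 0 < C1) (hC3 : 0 < C3) :
    ∃ C > 0, ∀ y z b p : ℝ, 0 < y → 0 < z → 0 ≤ b → 0 ≤ p →
    b ≤ C1 * ((y * z) ^ l / ((y - z) ^ 2 + (t / 2) ^ 2) ^ (l + 1)) →
    b ≤ C1 * (1 / ((y - z) ^ 2 + (t / 2) ^ 2)) →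
    p ≤ C3 * (y ^ l / (1 + y ^ 2) ^ (l + 1)) →
    t * b * p ≤ C * (z ^ l / (1 + z ^ 2) ^ (l + 1)) *
      ((1 + y ^ 2)⁻¹ + ((y - z) ^ 2 + (t / 2) ^ 2)⁻¹) := by
  set K : ℝ := 4 + 2 / (t / 2) ^ 2 with hK
  have hK0 : 0 < K := by positivity
  refine ⟨t * C1 * C3 * (K ^ (l + 1) + 4 ^ (l + 1)), by positivity, ?_⟩
  intro y z b p hy hz hb hp h1 h2 h3
  have hA : 0 < (y - z) ^ 2 + (t / 2) ^ 2 := by positivity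
  set A := (y - z) ^ 2 + (t / 2) ^ 2 with hAd
  have hZ : 0 < (1 + z ^ 2) ^ (l + 1) := by positivity
  have hzl : 0 < z ^ l := by positivity
  by_cases hcase : 1 + z ^ 2 ≤ K * A
  · have e1 : (1 + z ^ 2) ^ (l + 1) ≤ K ^ (l + 1) * A ^ (l + 1) := by
      rw [← Real.mul_rpow hK0.le hA.le]
      exact Real.rpow_le_rpow (by positivity) hcase (by linarith)
    have e2 : y ^ l * (y ^ l / (1 + y ^ 2) ^ (l + 1)) ≤ (1 + y ^ 2)⁻¹ := by
      rw [Real.rpow_add_one (by positivity), ← mul_div_assoc, div_le_iff₀ (by positivity),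
        ← Real.mul_rpow hy.le hy.le]
      have : (y * y) ^ l ≤ (1 + y ^ 2) ^ l :=
        Real.rpow_le_rpow (by positivity) (by nlinarith) hl.le
      calc _ ≤ _ := this
        _ = _ := by field_simp
    have e3 : z ^ l / A ^ (l + 1) ≤ K ^ (l + 1) * (z ^ l / (1 + z ^ 2) ^ (l + 1)) := by
      rw [← mul_div_assoc, div_le_div_iff₀ (by positivity) hZ]
      calc _ ≤ z ^ l * (K ^ (l + 1) * A ^ (l + 1)) := mul_le_mul_of_nonneg_left e1 hzl.le
        _ = _ := by ring
    calc t * b * p ≤ t * (C1 * ((y * z) ^ l / A ^ (l + 1))) *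
          (C3 * (y ^ l / (1 + y ^ 2) ^ (l + 1))) := by gcongr
      _ = t * C1 * C3 * (z ^ l / A ^ (l + 1)) * (y ^ l * (y ^ l / (1 + y ^ 2) ^ (l + 1))) := by
          rw [Real.mul_rpow hy.le hz.le]; ring
      _ ≤ t * C1 * C3 * (K ^ (l + 1) * (z ^ l / (1 + z ^ 2) ^ (l + 1))) * (1 + y ^ 2)⁻¹ := by
          gcongr
      _ = t * C1 * C3 * (K ^ (l + 1)) * (z ^ l / (1 + z ^ 2) ^ (l + 1)) * (1 + y ^ 2)⁻¹ := by ring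
      _ ≤ _ := by
          gcongr
          · have : (0:ℝ) < 4 ^ (l + 1) := by positivity
            linarith
          · have := inv_pos.2 hA
            linarith
  · push Not at hcase
    have hKA : K * A = 4 * (y - z) ^ 2 + 4 * (t / 2) ^ 2 + 2 +
        2 / (t / 2) ^ 2 * (y - z) ^ 2 := by rw [hK, hAd]; field_simp; ring
    have hnn : 0 ≤ 2 / (t / 2) ^ 2 * (y - z) ^ 2 := by positivity
    have hz1 : 1 < z := by nlinarith [sq_nonneg (y - z), sq_nonneg t]
    have hyz : z ≤ 2 * y := by
      by_contra hcon
      push Not at hcon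
      nlinarith [sq_nonneg t]
    have f1 : y / (1 + y ^ 2) ≤ 4 * (z / (1 + z ^ 2)) := by
      rw [← mul_div_assoc, div_le_div_iff₀ (by positivity) (by positivity)]
      nlinarith [mul_pos hy hz, mul_nonneg (mul_pos hy hz).le (sub_nonneg.2 hyz)]
    have f2 : (1 + y ^ 2)⁻¹ ≤ 4 * (1 + z ^ 2)⁻¹ := by
      rw [← div_eq_mul_inv, inv_eq_one_div, div_le_div_iff₀ (by positivity) (by positivity)]
      nlinarith
    have g : ∀ u : ℝ, 0 < u → u ^ l / (1 + u ^ 2) ^ (l + 1) =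
        (u / (1 + u ^ 2)) ^ l * (1 + u ^ 2)⁻¹ := fun u hu => by
      rw [Real.div_rpow hu.le (by positivity), Real.rpow_add_one (by positivity)]
      field_simp
    have e4 : y ^ l / (1 + y ^ 2) ^ (l + 1) ≤ 4 ^ (l + 1) * (z ^ l / (1 + z ^ 2) ^ (l + 1)) := by
      rw [g y hy, g z hz]
      calc _ ≤ (4 * (z / (1 + z ^ 2))) ^ l * (4 * (1 + z ^ 2)⁻¹) := by gcongr
        _ = _ := by
          rw [Real.mul_rpow (by norm_num) (by positivity), Real.rpow_add_one (by norm_num)]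
          ring
    calc t * b * p ≤ t * (C1 * (1 / A)) *
          (C3 * (y ^ l / (1 + y ^ 2) ^ (l + 1))) := by gcongr
      _ ≤ t * (C1 * (1 / A)) *
          (C3 * (4 ^ (l + 1) * (z ^ l / (1 + z ^ 2) ^ (l + 1)))) := by gcongr
      _ = t * C1 * C3 * (4 ^ (l + 1)) * (z ^ l / (1 + z ^ 2) ^ (l + 1)) * A⁻¹ := by ring
      _ ≤ _ := by
          gcongr
          · have : (0:ℝ) < K ^ (l + 1) := by positivity
            linarith
          · have : 0 < (1 + y ^ 2)⁻¹ := by positivity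
            linarith

lemma int_shift {τ : ℝ} (hτ : 0 < τ) : Integrable (fun y : ℝ => (y ^ 2 + τ ^ 2)⁻¹) := by
  have := (integrable_inv_one_add_sq.comp_div hτ.ne').const_mul ((τ ^ 2)⁻¹)
  refine this.congr (Filter.Eventually.of_forall fun y => ?_)
  beta_reduce
  field_simp
  ring

/-- For an odd-atom `a` and each `t > 0`,
`∫₀^∞ |t ∂_t P_t^λ(y,z) ∂_t P_t^λ(a)(y)| dy ≤ C z^λ/(1+z²)^{λ+1}` with `C` independent of `z`. -/
theorem statement5 (l : ℝ) (hl : 0 < l) (a : ℝ → ℝ) (ha : IsOddAtom a) :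
    ∀ t : ℝ, 0 < t → ∃ C > 0, ∀ z : ℝ, 0 < z →
      (∫ y in Ioi (0:ℝ),
          |t * deriv (fun s => besselPoissonKernel l y z s) t *
            deriv (fun s => ∫ w in Ioi (0:ℝ), besselPoissonKernel l y w s * a w) t|)
        ≤ C * z ^ l / (1 + z ^ 2) ^ (l + 1) := by
  intro t ht
  obtain ⟨C1, hC1, hB⟩ := bB_bounds hl
  obtain ⟨C3, hC3, hP⟩ := deriv_Pa_le hl ht ha
  obtain ⟨C, hC, hpt⟩ := pointwise_bound hl ht hC1 hC3
  have hτ : 0 < t / 2 := by linarith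
  have i1 : Integrable (fun y : ℝ => (1 + y ^ 2)⁻¹) := integrable_inv_one_add_sq
  have i2 := int_shift hτ
  set I1 := ∫ y : ℝ, (1 + y ^ 2)⁻¹ with hI1
  set I2 := ∫ y : ℝ, (y ^ 2 + (t / 2) ^ 2)⁻¹ with hI2
  have hI1n : 0 ≤ I1 := integral_nonneg fun y => by positivity
  have hI2n : 0 ≤ I2 := integral_nonneg fun y => by positivity
  refine ⟨C * (I1 + I2 + 1), by positivity, fun z hz => ?_⟩
  have i3 : Integrable (fun y : ℝ => ((y - z) ^ 2 + (t / 2) ^ 2)⁻¹) := i2.comp_sub_right z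
  have hI3 : ∫ y : ℝ, ((y - z) ^ 2 + (t / 2) ^ 2)⁻¹ = I2 :=
    integral_sub_right_eq_self (fun y : ℝ => (y ^ 2 + (t / 2) ^ 2)⁻¹) z
  set Z := z ^ l / (1 + z ^ 2) ^ (l + 1) with hZ
  have hZ0 : 0 < Z := by positivity
  have i4 := (i1.add i3).const_mul (C * Z)
  calc _ ≤ ∫ y in Ioi (0:ℝ), C * Z * ((1 + y ^ 2)⁻¹ + ((y - z) ^ 2 + (t / 2) ^ 2)⁻¹) := by
        refine integral_mono_of_nonneg (Filter.Eventually.of_forall fun y => abs_nonneg _)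
          i4.integrableOn ?_
        refine (ae_restrict_iff' measurableSet_Ioi).2 (Filter.Eventually.of_forall fun y hy => ?_)
        have hd := deriv_kernel_le hl hy hz ht
        have hb := hB (t / 2) y z hτ hy hz
        beta_reduce
        rw [abs_mul, abs_mul, abs_of_pos ht]
        exact hpt y z _ _ hy hz (abs_nonneg _) (abs_nonneg _) (hd.trans hb.1) (hd.trans hb.2)
          (hP y hy)
    _ ≤ ∫ y : ℝ, C * Z * ((1 + y ^ 2)⁻¹ + ((y - z) ^ 2 + (t / 2) ^ 2)⁻¹) := by
        refine setIntegral_le_integral i4 (Filter.Eventually.of_forall fun y => ?_)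
        simp only [Pi.zero_apply]
        positivity
    _ = C * Z * (I1 + I2) := by
        rw [integral_const_mul, integral_add i1 i3, hI3]
    _ ≤ C * Z * (I1 + I2 + 1) := 
        mul_le_mul_of_nonneg_left (by linarith) (by positivity)
    _ = _ := by rw [hZ]; ring
end
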